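/- arXiv:2211.04136 — 5 statements merged into one kernel-verified Lean document; each statement's English description precedes it below -/
import Mathlib

section
/- For every real μ ≥ 0, 2·∫_{−∞}^{0} (−μ)·(y − μ)·(1/√(2π))·exp(−(y − μ)²/2) dy + 2·∫_{0}^{∞} (y − μ)²·(1/√(2π))·exp(−(y − μ)²/2) dy = 1 + erf(μ/√2). -/
open Real MeasureTheory

/-- The Gauss error function, `erf x = (2/√π) ∫_0^x exp(-t²) dt`. -/
noncomputable def erf (x : ℝ) : ℝ := (2 / Real.sqrt π) * ∫ t in (0:ℝ)..x, Real.exp (-t ^ 2)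

theorem T1aux_int0 (μ : ℝ) : Integrable (fun y : ℝ => Real.exp (-(y - μ) ^ 2 / 2)) := by
  have h := (integrable_exp_neg_mul_sq (b := 1/2) (by norm_num)).comp_sub_right μ
  refine h.congr (Filter.Eventually.of_forall fun y => ?_)
  show Real.exp _ = Real.exp _
  congr 1; ring

theorem T1aux_int1 (μ : ℝ) :
    Integrable (fun y : ℝ => (y - μ) * Real.exp (-(y - μ) ^ 2 / 2)) := by
  have h := (integrable_mul_exp_neg_mul_sq (b := 1/2) (by norm_num)).comp_sub_right μ
  refine h.congr (Filter.Eventually.of_forall fun y => ?_)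
  show _ * Real.exp _ = _ * Real.exp _
  congr 2; ring

theorem T1aux_int2 (μ : ℝ) :
    Integrable (fun y : ℝ => (y - μ) ^ 2 * Real.exp (-(y - μ) ^ 2 / 2)) := by
  have h := (integrable_rpow_mul_exp_neg_mul_sq (b := 1/2) (by norm_num)
    (s := 2) (by norm_num)).comp_sub_right μ
  refine h.congr (Filter.Eventually.of_forall fun y => ?_)
  show (y - μ) ^ (2:ℝ) * Real.exp _ = _ * Real.exp _
  rw [Real.rpow_two]
  congr 2; ring

theorem T1aux_d0 (μ y : ℝ) : HasDerivAt (fun y : ℝ => Real.exp (-(y - μ) ^ 2 / 2))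
    (-((y - μ) * Real.exp (-(y - μ) ^ 2 / 2))) y := by
  have h := (((((hasDerivAt_id' y).sub_const μ).fun_pow 2).fun_neg).div_const 2).exp
  convert h using 1
  push_cast; ring

theorem T1aux_I1 (μ : ℝ) :
    ∫ y in Set.Iio (0:ℝ), (y - μ) * Real.exp (-(y - μ) ^ 2 / 2) = -Real.exp (-μ ^ 2 / 2) := by
  have hd := fun y => (T1aux_d0 μ y).neg
  simp only [neg_neg] at hd
  have ht := tendsto_zero_of_hasDerivAt_of_integrableOn_Iic (a := 0) (fun y _ => hd y)
    (T1aux_int1 μ).integrableOn (T1aux_int0 μ).neg.integrableOn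
  have h := integral_Iic_of_hasDerivAt_of_tendsto' (a := 0) (fun y _ => hd y)
    (T1aux_int1 μ).integrableOn ht
  rw [← integral_Iic_eq_integral_Iio, h]
  simp

theorem T1aux_I2 (μ : ℝ) :
    ∫ y in Set.Ioi (0:ℝ), (y - μ) ^ 2 * Real.exp (-(y - μ) ^ 2 / 2)
      = (∫ y in Set.Ioi (0:ℝ), Real.exp (-(y - μ) ^ 2 / 2)) - μ * Real.exp (-μ ^ 2 / 2) := by
  have hd : ∀ y, HasDerivAt (fun y : ℝ => (y - μ) * Real.exp (-(y - μ) ^ 2 / 2))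
      (Real.exp (-(y - μ) ^ 2 / 2) - (y - μ) ^ 2 * Real.exp (-(y - μ) ^ 2 / 2)) y := by
    intro y
    refine (((hasDerivAt_id' y).sub_const μ).fun_mul (T1aux_d0 μ y)).congr_deriv ?_
    ring
  have hi := (T1aux_int0 μ).sub (T1aux_int2 μ)
  have ht := tendsto_zero_of_hasDerivAt_of_integrableOn_Ioi (a := 0) (fun y _ => hd y)
    hi.integrableOn (T1aux_int1 μ).integrableOn
  have h := integral_Ioi_of_hasDerivAt_of_tendsto' (a := 0) (fun y _ => hd y)
    hi.integrableOn ht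
  rw [integral_sub (T1aux_int0 μ).integrableOn (T1aux_int2 μ).integrableOn] at h
  simp only [zero_sub, neg_sq] at h
  linarith

theorem T1aux_I3 (μ : ℝ) :
    ∫ y in Set.Ioi (0:ℝ), Real.exp (-(y - μ) ^ 2 / 2)
      = √2 * (∫ t in (0:ℝ)..(μ / √2), Real.exp (-t ^ 2)) + √(2 * π) / 2 := by
  have h1 := intervalIntegral.integral_interval_add_Ioi (a := 0) (b := μ)
    (T1aux_int0 μ).integrableOn (T1aux_int0 μ).integrableOn
  rw [← h1]
  congr 1
  · have e : (fun y : ℝ => Real.exp (-(y - μ) ^ 2 / 2))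
        = fun y => (fun t : ℝ => Real.exp (-t ^ 2)) (μ / √2 - y / √2) := by
      funext y
      show Real.exp _ = Real.exp _
      congr 1
      rw [← sub_div, div_pow, Real.sq_sqrt (by norm_num)]; ring
    rw [e, intervalIntegral.integral_comp_sub_div (fun t : ℝ => Real.exp (-t ^ 2))
      (c := √2) (by positivity)]
    simp
  · have h2 := integral_gaussian_Ioi (1/2)
    have h3 : ∫ y in Set.Ioi μ, Real.exp (-(y - μ) ^ 2 / 2)
        = ∫ x in Set.Ioi (0:ℝ), Real.exp (-(1/2) * x ^ 2) := by
      have hm := (measurePreserving_sub_right (volume : Measure ℝ) μ).setIntegral_preimage_emb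
        (MeasurableEquiv.subRight μ).measurableEmbedding
        (fun x => Real.exp (-(1/2) * x ^ 2)) (Set.Ioi 0)
      rw [← hm]
      simp only [Set.preimage_sub_const_Ioi, zero_add]
      congr 1; funext y; congr 1; ring
    rw [h3, h2]
    congr 2; ring




theorem T1_bias_correction_integrals (μ : ℝ) (hμ : 0 ≤ μ) :
    2 * (∫ y in Set.Iio (0:ℝ),
        (-μ) * (y - μ) * ((1 / Real.sqrt (2 * π)) * Real.exp (-(y - μ) ^ 2 / 2)))
      + 2 * (∫ y in Set.Ioi (0:ℝ),
        (y - μ) ^ 2 * ((1 / Real.sqrt (2 * π)) * Real.exp (-(y - μ) ^ 2 / 2)))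
      = 1 + erf (μ / Real.sqrt 2) := by
  have e1 : ∀ y : ℝ, (-μ) * (y - μ) * ((1 / √(2 * π)) * Real.exp (-(y - μ) ^ 2 / 2))
      = (-μ * (1 / √(2 * π))) * ((y - μ) * Real.exp (-(y - μ) ^ 2 / 2)) := fun y => by ring
  have e2 : ∀ y : ℝ, (y - μ) ^ 2 * ((1 / √(2 * π)) * Real.exp (-(y - μ) ^ 2 / 2))
      = (1 / √(2 * π)) * ((y - μ) ^ 2 * Real.exp (-(y - μ) ^ 2 / 2)) := fun y => by ring
  simp only [e1, e2]
  rw [integral_const_mul, integral_const_mul, T1aux_I1, T1aux_I2, T1aux_I3, erf,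
    Real.sqrt_mul (by norm_num)]
  have hp : 0 < √π := Real.sqrt_pos.mpr Real.pi_pos
  have h2 : 0 < √(2:ℝ) := by positivity
  generalize (∫ t in (0:ℝ)..(μ / √2), Real.exp (-t ^ 2)) = J
  generalize √(2:ℝ) = s at *
  field_simp
  ring
end

section
/- Let μ ≥ 0, let M₀ = {(0, t) : t ≥ 0} ⊆ ℝ², and let μ₀ = (0, μ). Let m̂ : ℝ² → ℝ² be any measurable function such that for Lebesgue-almost every w, m̂(w) ∈ M₀ and ‖w − m̂(w)‖ = inf{‖w − m‖ : m ∈ M₀}. Then 2·∫_{ℝ²} ⟪w − μ₀, m̂(w) − μ₀⟫ · (2π)⁻¹ · exp(−‖w − μ₀‖²/2) dw = 1 + erf(μ/√2). -/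
open Real MeasureTheory RealInnerProductSpace

/-- The point `(a, b)` of the Euclidean plane. -/
noncomputable def pt (a b : ℝ) : EuclideanSpace ℝ (Fin 2) :=
  (WithLp.equiv 2 (Fin 2 → ℝ)).symm ![a, b]

open Set Filter Topology in
lemma T1_oneDim (μ : ℝ) :
    ∫ s : ℝ, s * max s (-μ) * Real.exp (-(1/2) * s ^ 2)
      = ∫ s in Ioi (-μ), Real.exp (-(1/2) * s ^ 2) := by
  have hb : (0:ℝ) < 1/2 := by norm_num
  have i0 : Integrable fun s : ℝ => Real.exp (-(1/2) * s ^ 2) := integrable_exp_neg_mul_sq hb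
  have i1 : Integrable fun s : ℝ => s * Real.exp (-(1/2) * s ^ 2) :=
    integrable_mul_exp_neg_mul_sq hb
  have i2 : Integrable fun s : ℝ => s ^ 2 * Real.exp (-(1/2) * s ^ 2) := by
    have := integrable_rpow_mul_exp_neg_mul_sq hb (s := 2) (by norm_num)
    simpa using this
  have dE : ∀ s : ℝ, HasDerivAt (fun s : ℝ => Real.exp (-(1/2) * s ^ 2))
      (-(s * Real.exp (-(1/2) * s ^ 2))) s := by
    intro s
    have h := ((hasDerivAt_pow 2 s).const_mul (-(1/2) : ℝ)).exp
    convert h using 1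
    simp; ring
  have dF : ∀ s : ℝ, HasDerivAt (fun s : ℝ => s * Real.exp (-(1/2) * s ^ 2))
      (Real.exp (-(1/2) * s ^ 2) - s ^ 2 * Real.exp (-(1/2) * s ^ 2)) s := by
    intro s
    have h := (hasDerivAt_id' s).mul (dE s)
    exact h.congr_deriv (by ring)
  have tE : Tendsto (fun s : ℝ => Real.exp (-(1/2) * s ^ 2)) atBot (𝓝 0) :=
    tendsto_zero_of_hasDerivAt_of_integrableOn_Iic (a := -μ) (fun x _ => dE x)
      i1.neg.integrableOn i0.integrableOn
  have tF : Tendsto (fun s : ℝ => s * Real.exp (-(1/2) * s ^ 2)) atTop (𝓝 0) :=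
    tendsto_zero_of_hasDerivAt_of_integrableOn_Ioi (a := -μ) (fun x _ => dF x)
      (i0.sub i2).integrableOn i1.integrableOn
  have e1 := integral_Iic_of_hasDerivAt_of_tendsto' (a := -μ) (fun x _ => dE x)
      i1.neg.integrableOn tE
  have e2 := integral_Ioi_of_hasDerivAt_of_tendsto' (a := -μ) (fun x _ => dF x)
      (i0.sub i2).integrableOn tF
  rw [integral_sub i0.integrableOn i2.integrableOn] at e2
  rw [integral_neg] at e1
  have c1 : EqOn (fun s : ℝ => s * max s (-μ) * Real.exp (-(1/2) * s ^ 2))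
      (fun s => (-μ) * (s * Real.exp (-(1/2) * s ^ 2))) (Iic (-μ)) := by
    intro s hs
    simp only [max_eq_right (mem_Iic.1 hs)]; ring
  have c2 : EqOn (fun s : ℝ => s * max s (-μ) * Real.exp (-(1/2) * s ^ 2))
      (fun s => s ^ 2 * Real.exp (-(1/2) * s ^ 2)) (Ioi (-μ)) := by
    intro s hs
    simp only [max_eq_left (mem_Ioi.1 hs).le]; ring
  have j1 := ((i1.const_mul (-μ)).integrableOn (s := Iic (-μ))).congr_fun c1.symm measurableSet_Iic
  have j2 := (i2.integrableOn (s := Ioi (-μ))).congr_fun c2.symm measurableSet_Ioi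
  rw [← intervalIntegral.integral_Iic_add_Ioi j1 j2, setIntegral_congr_fun measurableSet_Iic c1,
    setIntegral_congr_fun measurableSet_Ioi c2, integral_const_mul]
  linear_combination μ * e1 - e2

open Set in
lemma T1_tail (μ : ℝ) : ∫ s in Ioi (-μ), Real.exp (-(1/2) * s ^ 2)
      = √(2 * π) / 2 * (1 + erf (μ / √2)) := by
  have hb : (0:ℝ) < 1/2 := by norm_num
  have i0 : Integrable fun s : ℝ => Real.exp (-(1/2) * s ^ 2) := integrable_exp_neg_mul_sq hb
  have h := intervalIntegral.integral_Ioi_sub_Ioi' (a := -μ) (b := 0)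
    (i0.integrableOn (s := Ioi (-μ))) (i0.integrableOn (s := Ioi 0))
  rw [integral_gaussian_Ioi] at h
  have h2 : ∫ s in (-μ)..0, Real.exp (-(1/2) * s ^ 2) = ∫ s in (0:ℝ)..μ, Real.exp (-(1/2) * s ^ 2) := by
    have := intervalIntegral.integral_comp_neg (a := 0) (b := μ)
      (fun s : ℝ => Real.exp (-(1/2) * s ^ 2))
    simpa using this.symm
  have s2 : √(2:ℝ) ≠ 0 := by positivity
  have sp : √π ≠ 0 := by positivity
  have h3 := intervalIntegral.integral_comp_div (a := 0) (b := μ)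
      (fun s : ℝ => Real.exp (- s ^ 2)) s2
  have h4 : ∀ s : ℝ, Real.exp (-(s / √2) ^ 2) = Real.exp (-(1/2) * s ^ 2) := by
    intro s; congr 1; rw [div_pow, Real.sq_sqrt (by norm_num)]; ring
  simp only [h4, zero_div, smul_eq_mul] at h3
  have h5 : π / (1/2) = 2 * π := by ring
  rw [h2, h3, h5] at h
  rw [erf, sub_eq_iff_eq_add.1 h, Real.sqrt_mul (by norm_num)]
  field_simp
  ring

lemma T1_proj (w m : EuclideanSpace ℝ (Fin 2))
    (h : m ∈ {w | ∃ t : ℝ, 0 ≤ t ∧ w = pt 0 t})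
    (hd : ‖w - m‖ = sInf ((fun m => ‖w - m‖) '' {w | ∃ t : ℝ, 0 ≤ t ∧ w = pt 0 t})) :
    m = pt 0 (max (w 1) 0) := by
  obtain ⟨t, ht, rfl⟩ := h
  have hle : ‖w - pt 0 t‖ ≤ ‖w - pt 0 (max (w 1) 0)‖ := by
    rw [hd]
    exact csInf_le ⟨0, by rintro _ ⟨m, _, rfl⟩; positivity⟩ ⟨_, ⟨_, le_max_right _ _, rfl⟩, rfl⟩
  have h2 := pow_le_pow_left₀ (norm_nonneg _) hle 2
  simp only [EuclideanSpace.norm_sq_eq, Fin.sum_univ_two, pt, PiLp.sub_apply] at h2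
  simp at h2
  congr 1
  rcases le_total (w 1) 0 with h | h
  · rw [max_eq_right h] at h2 ⊢
    nlinarith
  · rw [max_eq_left h] at h2 ⊢
    nlinarith

theorem T1_bias_correction (μ : ℝ) (hμ : 0 ≤ μ)
    (M₀ : Set (EuclideanSpace ℝ (Fin 2)))
    (hM₀ : M₀ = {w | ∃ t : ℝ, 0 ≤ t ∧ w = pt 0 t})
    (μ₀ : EuclideanSpace ℝ (Fin 2)) (hμ₀ : μ₀ = pt 0 μ)
    (mhat : EuclideanSpace ℝ (Fin 2) → EuclideanSpace ℝ (Fin 2))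
    (hmeas : Measurable mhat)
    (hproj : ∀ᵐ w : EuclideanSpace ℝ (Fin 2),
      mhat w ∈ M₀ ∧ ‖w - mhat w‖ = sInf ((fun m => ‖w - m‖) '' M₀)) :
    2 * (∫ w : EuclideanSpace ℝ (Fin 2),
        ⟪w - μ₀, mhat w - μ₀⟫ * ((2 * π)⁻¹ * Real.exp (-‖w - μ₀‖ ^ 2 / 2)))
      = 1 + erf (μ / Real.sqrt 2) := by
  subst hM₀ hμ₀
  let G : ℝ × ℝ → ℝ := fun p => Real.exp (-(1/2) * p.1 ^ 2) *
    ((2 * π)⁻¹ * ((p.2 - μ) * max (p.2 - μ) (-μ) * Real.exp (-(1/2) * (p.2 - μ) ^ 2)))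
  have e1 : (∫ w : EuclideanSpace ℝ (Fin 2),
        ⟪w - pt 0 μ, mhat w - pt 0 μ⟫ * ((2 * π)⁻¹ * Real.exp (-‖w - pt 0 μ‖ ^ 2 / 2)))
      = ∫ w : EuclideanSpace ℝ (Fin 2), G (MeasurableEquiv.finTwoArrow (WithLp.ofLp w)) := by
    apply integral_congr_ae
    filter_upwards [hproj] with w hw
    rw [T1_proj w _ hw.1 hw.2, EuclideanSpace.norm_sq_eq]
    have hm : max (w 1) 0 - μ = max (w 1 - μ) (-μ) := by
      rw [← max_sub_sub_right, zero_sub]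
    have hx : Real.exp (-(w 0 ^ 2 + (w 1 - μ) ^ 2) / 2)
        = Real.exp (-(1/2) * w 0 ^ 2) * Real.exp (-(1/2) * (w 1 - μ) ^ 2) := by
      rw [← Real.exp_add]; congr 1; ring
    simp [G, Fin.sum_univ_two, pt, PiLp.inner_apply, MeasurableEquiv.finTwoArrow] at hx ⊢
    rw [hx, hm]
    ring
  have e2 : ∫ w : EuclideanSpace ℝ (Fin 2), G (MeasurableEquiv.finTwoArrow (WithLp.ofLp w))
      = ∫ p, G p := by
    rw [← (volume_preserving_finTwoArrow ℝ).integral_comp' G]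
    exact (PiLp.volume_preserving_ofLp (Fin 2)).integral_comp
      (MeasurableEquiv.toLp 2 (Fin 2 → ℝ)).symm.measurableEmbedding
      (fun v => G (MeasurableEquiv.finTwoArrow v))
  rw [e1, e2, Measure.volume_eq_prod, integral_prod_mul
    (fun x : ℝ => Real.exp (-(1/2) * x ^ 2))
    (fun y : ℝ => (2 * π)⁻¹ * ((y - μ) * max (y - μ) (-μ) * Real.exp (-(1/2) * (y - μ) ^ 2))),
    integral_const_mul,
    integral_sub_right_eq_self (fun s : ℝ => s * max s (-μ) * Real.exp (-(1/2) * s ^ 2)) μ,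
    T1_oneDim, T1_tail, integral_gaussian]
  have h5 : π / (1/2) = 2 * π := by ring
  rw [h5]
  have h6 : √(2 * π) * √(2 * π) = 2 * π := Real.mul_self_sqrt (by positivity)
  have : (2 * π)⁻¹ * (2 * π) = 1 := inv_mul_cancel₀ (by positivity)
  linear_combination (1 + erf (μ / √2)) * (2 * π)⁻¹ * h6 + (1 + erf (μ / √2)) * this
end

section
/- Let α₀ ∈ (0, π/2), set β₀ = (π/2 − α₀)/2, let μ ≥ 0 and μ₀ = (0, μ). Let M₀ ⊆ ℝ² be the union of the three half-lines {(0, t) : t ≥ 0}, {t·(cos α₀, −sin α₀) : t ≥ 0}, and {t·(−cos α₀, −sin α₀) : t ≥ 0}. Let m̂ : ℝ² → ℝ² be any measurable function such that for Lebesgue-almost every w, m̂(w) ∈ M₀ and ‖w − m̂(w)‖ = inf{‖w − m‖ : m ∈ M₀}. Then 2·∫_{ℝ²} ⟪w − μ₀, m̂(w) − μ₀⟫ · (2π)⁻¹ · exp(−‖w − μ₀‖²/2) dw = √(2/π)·∫_{0}^{∞} (y − μ)²·exp(−(y − μ)²/2)·erf((y·cot β₀)/√2) dy + (2/π)·∫_{−π/2}^{β₀}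 ∫_{0}^{∞} r·(r²·cos²(φ + α₀) − μ·r·(sin φ − sin α₀·cos(φ + α₀)) + μ²)·exp(−(r² − 2μ·r·sin φ + μ²)/2) dr dφ. -/
open Real MeasureTheory RealInnerProductSpace

noncomputable def gA (μ : ℝ) (p : ℝ × ℝ) : ℝ :=
  (p.2 - μ) ^ 2 * Real.exp (-(p.1 ^ 2 + (p.2 - μ) ^ 2) / 2)

noncomputable def gB (α μ : ℝ) (p : ℝ × ℝ) : ℝ :=
  ((p.1 * Real.cos α - p.2 * Real.sin α) ^ 2 - μ * p.2
    + μ * Real.sin α * (p.1 * Real.cos α - p.2 * Real.sin α) + μ ^ 2)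
    * Real.exp (-(p.1 ^ 2 + (p.2 - μ) ^ 2) / 2)

def SA (β : ℝ) : Set (ℝ × ℝ) := {p | |p.1| * Real.sin β < p.2 * Real.cos β}
def SB (β : ℝ) : Set (ℝ × ℝ) := {p | 0 < p.1 ∧ p.2 * Real.cos β < p.1 * Real.sin β}
def SC (β : ℝ) : Set (ℝ × ℝ) := {p | p.1 < 0 ∧ p.2 * Real.cos β < -p.1 * Real.sin β}

lemma measSA (β : ℝ) : MeasurableSet (SA β) :=
  measurableSet_lt (by fun_prop) (by fun_prop)
lemma measSB (β : ℝ) : MeasurableSet (SB β) := by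
  unfold SB
  measurability
lemma measSC (β : ℝ) : MeasurableSet (SC β) := by
  unfold SC
  measurability

lemma ae_lin (a b : ℝ) (h : a ≠ 0 ∨ b ≠ 0) : ∀ᵐ p : ℝ × ℝ, a * p.1 + b * p.2 ≠ 0 := by
  let L : (ℝ × ℝ) →ₗ[ℝ] ℝ := a • LinearMap.fst ℝ ℝ ℝ + b • LinearMap.snd ℝ ℝ ℝ
  have h1 : LinearMap.ker L ≠ ⊤ := by
    intro hh
    rw [LinearMap.ker_eq_top] at hh
    have h2 : L (1, 0) = 0 := by rw [hh]; rfl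
    have h3 : L (0, 1) = 0 := by rw [hh]; rfl
    simp [L] at h2 h3
    tauto
  have h4 := Measure.addHaar_submodule (volume : Measure (ℝ × ℝ)) _ h1
  rw [ae_iff]
  convert h4 using 2
  ext p
  simp [L]

lemma int_gauss_pow (n : ℕ) : Integrable (fun x : ℝ => x ^ n * Real.exp (-x ^ 2 / 2)) := by
  have := integrable_rpow_mul_exp_neg_mul_sq (b := 1 / 2) (by norm_num) (s := n)
    (by have : (0:ℝ) ≤ n := by positivity
        linarith)
  refine this.congr (Filter.Eventually.of_forall fun x => ?_)
  simp only [Real.rpow_natCast]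
  congr 2
  ring

lemma int_mono (μ : ℝ) (m n : ℕ) : Integrable (fun p : ℝ × ℝ =>
    p.1 ^ m * (p.2 - μ) ^ n * Real.exp (-(p.1 ^ 2 + (p.2 - μ) ^ 2) / 2)) := by
  have := (int_gauss_pow m).mul_prod ((int_gauss_pow n).comp_sub_right μ)
  refine this.congr (Filter.Eventually.of_forall fun p => ?_)
  simp only
  rw [show -(p.1 ^ 2 + (p.2 - μ) ^ 2) / 2 = -p.1 ^ 2 / 2 + -(p.2 - μ) ^ 2 / 2 by ring, Real.exp_add]
  ring

lemma int_gA (μ : ℝ) : Integrable (gA μ) := by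
  refine (int_mono μ 0 2).congr (Filter.Eventually.of_forall fun p => ?_)
  simp [gA]

lemma int_gB (α μ : ℝ) : Integrable (gB α μ) := by
  have h := ((((((int_mono μ 2 0).const_mul (Real.cos α ^ 2)).add
    ((int_mono μ 1 1).const_mul (-2 * Real.cos α * Real.sin α))).add
    ((int_mono μ 0 2).const_mul (Real.sin α ^ 2))).add
    ((int_mono μ 1 0).const_mul (-μ * Real.cos α * Real.sin α))).add
    ((int_mono μ 0 1).const_mul (μ * Real.sin α ^ 2 - μ)))
  refine h.congr (Filter.Eventually.of_forall fun p => ?_)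
  simp only [gB, Pi.add_apply]
  ring

lemma polar_int (f : ℝ × ℝ → ℝ) (hf : Integrable f) :
    IntegrableOn (fun p : ℝ × ℝ => p.1 * f (polarCoord.symm p)) polarCoord.target := by
  have h := integrableOn_image_iff_integrableOn_abs_det_fderiv_smul (volume : Measure (ℝ × ℝ))
    (s := polarCoord.target) (f := polarCoord.symm) (f' := fderivPolarCoordSymm)
    polarCoord.open_target.measurableSet
    (fun p _ => (hasFDerivAt_polarCoord_symm p).hasFDerivWithinAt) polarCoord.symm.injOn f
  have h2 := h.1 hf.integrableOn
  refine h2.congr_fun ?_ polarCoord.open_target.measurableSet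
  intro p hp
  simp only [det_fderivPolarCoordSymm, smul_eq_mul]
  rw [abs_of_pos]
  exact hp.1

lemma int_B (α β μ : ℝ) (hβ : β ∈ Set.Ioo 0 (π / 2)) :
    ∫ p in SB β, gB α μ p = ∫ φ in (-(π / 2))..β, ∫ r in Set.Ioi (0:ℝ),
            r * (r ^ 2 * Real.cos (φ + α) ^ 2
                - μ * r * (Real.sin φ - Real.sin α * Real.cos (φ + α)) + μ ^ 2)
              * Real.exp (-(r ^ 2 - 2 * μ * r * Real.sin φ + μ ^ 2) / 2) := by
  obtain ⟨hb0, hb1⟩ := hβ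
  have hpi := Real.pi_pos
  have hsub : Set.Ioi (0:ℝ) ×ˢ Set.Ioo (-(π / 2)) β ⊆ polarCoord.target := by
    rintro ⟨r, φ⟩ ⟨h1, h2⟩
    simp only [polarCoord_target, Set.mem_prod, Set.mem_Ioo, Set.mem_Ioi] at *
    exact ⟨h1, by linarith, by linarith⟩
  have hI := (polar_int _ (int_gB α μ)).mono_set hsub
  rw [← integral_indicator (measSB β), ← integral_comp_polarCoord_symm]
  have e1 : ∀ p ∈ polarCoord.target, p.1 • (SB β).indicator (gB α μ) (polarCoord.symm p)
      = (Set.Ioi (0:ℝ) ×ˢ Set.Ioo (-(π / 2)) β).indicator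
        (fun p : ℝ × ℝ => p.1 * gB α μ (polarCoord.symm p)) p := by
    rintro ⟨r, φ⟩ hp
    simp only [polarCoord_target, Set.mem_prod, Set.mem_Ioo, Set.mem_Ioi] at hp
    obtain ⟨hr, hp1, hp2⟩ := hp
    have key : polarCoord.symm (r, φ) ∈ SB β ↔ (r, φ) ∈ Set.Ioi (0:ℝ) ×ˢ Set.Ioo (-(π / 2)) β := by
      simp only [polarCoord_symm_apply, SB, Set.mem_ofPred_eq, Set.mem_prod, Set.mem_Ioo, Set.mem_Ioi]
      have hs : r * Real.sin φ * Real.cos β < r * Real.cos φ * Real.sin β ↔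
          Real.sin (φ - β) < 0 := by
        rw [Real.sin_sub]
        constructor
        · intro h
          by_contra h'
          have := mul_nonneg hr.le (not_lt.1 h')
          nlinarith
        · intro h
          have := mul_pos hr (neg_pos.2 h)
          nlinarith
      rw [hs]
      constructor
      · rintro ⟨h1, h2⟩
        have hc : 0 < Real.cos φ := pos_of_mul_pos_right h1 hr.le
        have h3 : -(π / 2) < φ := by
          by_contra h
          have := Real.cos_nonpos_of_pi_div_two_le_of_le (x := -φ) (by linarith) (by linarith)
          rw [Real.cos_neg] at this
          linarith
        have h4 : φ < π / 2 := by
          by_contra h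
          have := Real.cos_nonpos_of_pi_div_two_le_of_le (x := φ) (by linarith) (by linarith)
          linarith
        refine ⟨hr, h3, ?_⟩
        by_contra h
        have := Real.sin_nonneg_of_nonneg_of_le_pi (x := φ - β) (by linarith) (by linarith)
        linarith
      · rintro ⟨-, h1, h2⟩
        exact ⟨mul_pos hr (Real.cos_pos_of_mem_Ioo ⟨h1, by linarith⟩),
          Real.sin_neg_of_neg_of_neg_pi_lt (by linarith) (by linarith)⟩
    by_cases h : polarCoord.symm (r, φ) ∈ SB β
    · rw [Set.indicator_of_mem h, Set.indicator_of_mem (key.1 h)]; rfl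
    · rw [Set.indicator_of_notMem h, Set.indicator_of_notMem (fun h' => h (key.2 h'))]; simp
  rw [setIntegral_congr_fun polarCoord.open_target.measurableSet e1,
    setIntegral_indicator (measurableSet_Ioi.prod measurableSet_Ioo),
    Set.inter_eq_self_of_subset_right hsub]
  rw [Measure.volume_eq_prod] at hI ⊢
  have hF := setIntegral_prod _ hI.swap
  simp only [Function.comp_def] at hF
  rw [← setIntegral_prod_swap, hF,
    intervalIntegral.integral_of_le (by linarith), ← integral_Ioc_eq_integral_Ioo]
  refine setIntegral_congr_fun measurableSet_Ioc fun φ _ => ?_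
  refine setIntegral_congr_fun measurableSet_Ioi fun r _ => ?_
  simp only [Prod.swap_prod_mk, polarCoord_symm_apply, gB]
  have h1 : r * Real.cos φ * Real.cos α - r * Real.sin φ * Real.sin α = r * Real.cos (φ + α) := by
    rw [Real.cos_add]; ring
  have h2 : -((r * Real.cos φ) ^ 2 + (r * Real.sin φ - μ) ^ 2) / 2
      = -(r ^ 2 - 2 * μ * r * Real.sin φ + μ ^ 2) / 2 := by
    linear_combination (-r ^ 2 / 2) * Real.sin_sq_add_cos_sq φ
  rw [h1, h2]
  ring

lemma int_C (α β μ : ℝ) :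
    ∫ p in SC β, gB α μ (-p.1, p.2) = ∫ p in SB β, gB α μ p := by
  rw [← integral_indicator (measSB β), ← integral_indicator (measSC β)]
  have hmp : MeasurePreserving (fun p : ℝ × ℝ => (-p.1, p.2)) volume volume :=
    (Measure.measurePreserving_neg (volume : Measure ℝ)).prod (MeasurePreserving.id volume)
  have hme : MeasurableEmbedding (fun p : ℝ × ℝ => (-p.1, p.2)) :=
    ((Homeomorph.neg ℝ).prodCongr (Homeomorph.refl ℝ)).measurableEmbedding
  rw [← hmp.integral_comp hme ((SB β).indicator (gB α μ))]
  congr 1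
  ext p
  by_cases h : p ∈ SC β
  · have h' : (-p.1, p.2) ∈ SB β := by
      simp only [SB, SC, Set.mem_ofPred_eq] at *
      exact ⟨by linarith [h.1], h.2⟩
    rw [Set.indicator_of_mem h, Set.indicator_of_mem h']
  · have h' : (-p.1, p.2) ∉ SB β := by
      simp only [SB, SC, Set.mem_ofPred_eq] at *
      exact fun hh => h ⟨by linarith [hh.1], hh.2⟩
    rw [Set.indicator_of_notMem h, Set.indicator_of_notMem h']

lemma erf_eq (a : ℝ) : ∫ x in (-a)..a, Real.exp (-x ^ 2 / 2)
    = Real.sqrt (2 * π) * erf (a / Real.sqrt 2) := by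
  have hi : ∀ u v : ℝ, IntervalIntegrable (fun x : ℝ => Real.exp (-x ^ 2 / 2)) volume u v :=
    fun u v => (by fun_prop : Continuous fun x : ℝ => Real.exp (-x ^ 2 / 2)).intervalIntegrable u v
  have hsplit := intervalIntegral.integral_add_adjacent_intervals (hi (-a) 0) (hi 0 a)
  have hneg : ∫ x in (-a)..0, Real.exp (-x ^ 2 / 2) = ∫ x in (0:ℝ)..a, Real.exp (-x ^ 2 / 2) := by
    have := intervalIntegral.integral_comp_neg (a := 0) (b := a)
      (fun x : ℝ => Real.exp (-x ^ 2 / 2))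
    simp only [neg_zero, neg_sq] at this
    exact this.symm
  have h2 : Real.sqrt 2 ≠ 0 := by positivity
  have hsc := intervalIntegral.integral_comp_div (a := 0) (b := a)
    (fun t : ℝ => Real.exp (-t ^ 2)) h2
  have h3 : ∀ x : ℝ, -(x / Real.sqrt 2) ^ 2 = -x ^ 2 / 2 := by
    intro x
    rw [div_pow, Real.sq_sqrt (by norm_num)]; ring
  simp only [h3, zero_div, smul_eq_mul] at hsc
  rw [← hsplit, hneg, hsc, erf, Real.sqrt_mul (by norm_num)]
  have h4 : Real.sqrt π ≠ 0 := by positivity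
  field_simp
  ring

lemma int_A (β μ : ℝ) (hβ : β ∈ Set.Ioo 0 (π / 2)) :
    ∫ p in SA β, gA μ p = Real.sqrt (2 * π) * ∫ y in Set.Ioi (0:ℝ),
      (y - μ) ^ 2 * Real.exp (-(y - μ) ^ 2 / 2) * erf (y * Real.cot β / Real.sqrt 2) := by
  have hs : 0 < Real.sin β := Real.sin_pos_of_pos_of_lt_pi hβ.1 (by linarith [hβ.2, Real.pi_pos])
  have hc : 0 < Real.cos β := Real.cos_pos_of_mem_Ioo ⟨by linarith [hβ.1, Real.pi_pos], hβ.2⟩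
  rw [← integral_indicator (measSA β)]
  have hI := (int_gA μ).indicator (measSA β)
  rw [Measure.volume_eq_prod] at hI ⊢
  rw [integral_prod_symm _ hI, ← integral_const_mul, ← integral_indicator measurableSet_Ioi]
  congr 1
  ext y
  have hmem : ∀ x, (x, y) ∈ SA β ↔ x ∈ Set.Ioo (-(y * Real.cot β)) (y * Real.cot β) := by
    intro x
    rw [Set.mem_Ioo, ← abs_lt, Real.cot_eq_cos_div_sin, ← mul_div_assoc, lt_div_iff₀ hs]
    rfl
  have hfun : (fun x => (SA β).indicator (gA μ) (x, y)) =
      (Set.Ioo (-(y * Real.cot β)) (y * Real.cot β)).indicator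
        (fun x => ((y - μ) ^ 2 * Real.exp (-(y - μ) ^ 2 / 2)) * Real.exp (-x ^ 2 / 2)) := by
    ext x
    by_cases h : (x, y) ∈ SA β
    · rw [Set.indicator_of_mem h, Set.indicator_of_mem ((hmem x).1 h), gA]
      simp only
      rw [show -(x ^ 2 + (y - μ) ^ 2) / 2 = -(y - μ) ^ 2 / 2 + -x ^ 2 / 2 by ring, Real.exp_add]
      ring
    · rw [Set.indicator_of_notMem h, Set.indicator_of_notMem (fun h' => h ((hmem x).2 h'))]
  rw [hfun, integral_indicator measurableSet_Ioo, integral_const_mul]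
  have hk : 0 < Real.cot β := by rw [Real.cot_eq_cos_div_sin]; positivity
  by_cases hy : y ∈ Set.Ioi (0:ℝ)
  · rw [Set.indicator_of_mem hy]
    have : 0 < y * Real.cot β := mul_pos hy hk
    rw [← integral_Ioc_eq_integral_Ioo, ← intervalIntegral.integral_of_le (by linarith), erf_eq]
    ring
  · rw [Set.indicator_of_notMem hy]
    have : y * Real.cot β ≤ 0 := mul_nonpos_of_nonpos_of_nonneg (not_lt.1 hy) hk.le
    rw [Set.Ioo_eq_empty (by linarith)]
    simp

lemma norm_pt (x y a b : ℝ) : ‖pt x y - pt a b‖ ^ 2 = (x - a) ^ 2 + (y - b) ^ 2 := by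
  rw [EuclideanSpace.norm_sq_eq]
  simp [pt, Fin.sum_univ_two]

lemma inner_pt (x y a b c d : ℝ) : ⟪pt x y - pt a b, pt c d - pt a b⟫
    = (x - a) * (c - a) + (y - b) * (d - b) := by
  simp [pt, PiLp.inner_apply, Fin.sum_univ_two]
  ring

lemma smul_pt (t a b : ℝ) : t • pt a b = pt (t * a) (t * b) := by
  ext i
  fin_cases i <;> simp [pt]

lemma mp_pt : MeasurePreserving (fun p : ℝ × ℝ => pt p.1 p.2) volume volume :=
  (PiLp.volume_preserving_toLp (Fin 2)).comp (volume_preserving_finTwoArrow ℝ).symm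

lemma me_pt : MeasurableEmbedding (fun p : ℝ × ℝ => pt p.1 p.2) :=
  (MeasurableEquiv.toLp 2 (Fin 2 → ℝ)).measurableEmbedding.comp
    (MeasurableEquiv.finTwoArrow (α := ℝ)).symm.measurableEmbedding

lemma pick (a b : Fin 3 → ℝ) (hab : ∀ i, a i ^ 2 + b i ^ 2 = 1) (x y : ℝ) (i₀ : Fin 3)
    (hp : 0 < x * a i₀ + y * b i₀)
    (hq : ∀ j, j ≠ i₀ → x * a j + y * b j < x * a i₀ + y * b i₀)
    (m : EuclideanSpace ℝ (Fin 2)) (hm : ∃ i, ∃ t : ℝ, 0 ≤ t ∧ m = pt (t * a i) (t * b i))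
    (hmin : ∀ i, ∀ t : ℝ, 0 ≤ t → ‖pt x y - m‖ ≤ ‖pt x y - pt (t * a i) (t * b i)‖) :
    m = pt ((x * a i₀ + y * b i₀) * a i₀) ((x * a i₀ + y * b i₀) * b i₀) := by
  obtain ⟨i, t, ht, rfl⟩ := hm
  have h := hmin i₀ _ hp.le
  have h2 := pow_le_pow_left₀ (norm_nonneg _) h 2
  rw [norm_pt, norm_pt] at h2
  have e1 := hab i
  have e2 := hab i₀
  set p := x * a i₀ + y * b i₀ with hpdef
  have l1 : (x - t * a i) ^ 2 + (y - t * b i) ^ 2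
      = x ^ 2 + y ^ 2 - 2 * t * (x * a i + y * b i) + t ^ 2 := by
    linear_combination t ^ 2 * e1
  have l2 : (x - p * a i₀) ^ 2 + (y - p * b i₀) ^ 2 = x ^ 2 + y ^ 2 - p ^ 2 := by
    linear_combination p ^ 2 * e2 + 2 * p * hpdef
  rw [l1, l2] at h2
  by_cases hi : i = i₀
  · subst hi
    have : (t - p) ^ 2 ≤ 0 := by rw [← hpdef] at h2; nlinarith
    have : t - p = 0 := by
      have h0 := sq_nonneg (t - p)
      exact pow_eq_zero_iff (two_ne_zero) |>.1 (le_antisymm this h0)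
    rw [show t = p by linarith]
  · exfalso
    have hh := hq i hi
    rcases ht.eq_or_lt with h0 | h0
    · subst h0; nlinarith [sq_nonneg p, mul_pos hp hp]
    · nlinarith [mul_pos h0 (sub_pos.2 hh), sq_nonneg (t - p)]

lemma M_iff (α₀ : ℝ) (m : EuclideanSpace ℝ (Fin 2)) :
    m ∈ ({w | ∃ t : ℝ, 0 ≤ t ∧ w = pt 0 t} ∪
      {w | ∃ t : ℝ, 0 ≤ t ∧ w = t • pt (Real.cos α₀) (-Real.sin α₀)} ∪
      {w | ∃ t : ℝ, 0 ≤ t ∧ w = t • pt (-Real.cos α₀) (-Real.sin α₀)} :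
        Set (EuclideanSpace ℝ (Fin 2))) ↔
    ∃ i : Fin 3, ∃ t : ℝ, 0 ≤ t ∧ m = pt (t * ![0, Real.cos α₀, -Real.cos α₀] i)
      (t * ![1, -Real.sin α₀, -Real.sin α₀] i) := by
  simp only [Set.mem_union, Set.mem_ofPred_eq, smul_pt, Fin.exists_fin_succ]
  simp [or_assoc]

theorem T3_bias_correction (α₀ : ℝ) (hα₀ : α₀ ∈ Set.Ioo 0 (π / 2))
    (β₀ : ℝ) (hβ₀ : β₀ = (π / 2 - α₀) / 2)
    (μ : ℝ) (hμ : 0 ≤ μ)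
    (μ₀ : EuclideanSpace ℝ (Fin 2)) (hμ₀ : μ₀ = pt 0 μ)
    (M₀ : Set (EuclideanSpace ℝ (Fin 2)))
    (hM₀ : M₀ = {w | ∃ t : ℝ, 0 ≤ t ∧ w = pt 0 t} ∪
      {w | ∃ t : ℝ, 0 ≤ t ∧ w = t • pt (Real.cos α₀) (-Real.sin α₀)} ∪
      {w | ∃ t : ℝ, 0 ≤ t ∧ w = t • pt (-Real.cos α₀) (-Real.sin α₀)})
    (mhat : EuclideanSpace ℝ (Fin 2) → EuclideanSpace ℝ (Fin 2))
    (hmeas : Measurable mhat)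
    (hproj : ∀ᵐ w : EuclideanSpace ℝ (Fin 2),
      mhat w ∈ M₀ ∧ ‖w - mhat w‖ = sInf ((fun m => ‖w - m‖) '' M₀)) :
    2 * (∫ w : EuclideanSpace ℝ (Fin 2),
        ⟪w - μ₀, mhat w - μ₀⟫ * ((2 * π)⁻¹ * Real.exp (-‖w - μ₀‖ ^ 2 / 2)))
      = Real.sqrt (2 / π) * (∫ y in Set.Ioi (0:ℝ),
            (y - μ) ^ 2 * Real.exp (-(y - μ) ^ 2 / 2) * erf (y * Real.cot β₀ / Real.sqrt 2))
        + (2 / π) * ∫ φ in (-(π / 2))..β₀, ∫ r in Set.Ioi (0:ℝ),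
            r * (r ^ 2 * Real.cos (φ + α₀) ^ 2
                - μ * r * (Real.sin φ - Real.sin α₀ * Real.cos (φ + α₀)) + μ ^ 2)
              * Real.exp (-(r ^ 2 - 2 * μ * r * Real.sin φ + μ ^ 2) / 2) := by
  obtain ⟨ha0, ha1⟩ := hα₀
  have hβ : β₀ ∈ Set.Ioo 0 (π / 2) := ⟨by linarith, by linarith⟩
  have hsb : 0 < Real.sin β₀ :=
    Real.sin_pos_of_pos_of_lt_pi hβ.1 (by linarith [hβ.2, Real.pi_pos])
  have hcb : 0 < Real.cos β₀ :=
    Real.cos_pos_of_mem_Ioo ⟨by linarith [hβ.1, Real.pi_pos], hβ.2⟩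
  have hs : 0 < Real.sin α₀ := Real.sin_pos_of_pos_of_lt_pi ha0 (by linarith)
  have hc : 0 < Real.cos α₀ := Real.cos_pos_of_mem_Ioo ⟨by linarith, ha1⟩
  have hα : α₀ = π / 2 - 2 * β₀ := by linarith
  have hs2 : 1 + Real.sin α₀ = 2 * Real.cos β₀ * Real.cos β₀ := by
    rw [hα, Real.sin_pi_div_two_sub, Real.cos_two_mul]; ring
  have hc2 : Real.cos α₀ = 2 * Real.cos β₀ * Real.sin β₀ := by
    rw [hα, Real.cos_pi_div_two_sub, Real.sin_two_mul]; ring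
  have hsc : Real.sin α₀ ^ 2 + Real.cos α₀ ^ 2 = 1 := Real.sin_sq_add_cos_sq α₀
  have hunit : ∀ i : Fin 3, ![0, Real.cos α₀, -Real.cos α₀] i ^ 2
      + ![1, -Real.sin α₀, -Real.sin α₀] i ^ 2 = 1 := by
    intro i
    fin_cases i <;> simp
  -- comparison of scalar products
  have hlt : ∀ x y : ℝ, y * Real.cos β₀ < x * Real.sin β₀ →
      y * (1 + Real.sin α₀) < x * Real.cos α₀ := by
    intro x y h
    rw [hs2, hc2]
    nlinarith [mul_pos hcb (sub_pos.2 h)]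
  have hgt : ∀ x y : ℝ, x * Real.sin β₀ < y * Real.cos β₀ →
      x * Real.cos α₀ < y * (1 + Real.sin α₀) := by
    intro x y h
    rw [hs2, hc2]
    nlinarith [mul_pos hcb (sub_pos.2 h)]
  have hproj' : ∀ᵐ p : ℝ × ℝ, mhat (pt p.1 p.2) ∈ M₀ ∧
      ‖pt p.1 p.2 - mhat (pt p.1 p.2)‖ = sInf ((fun m => ‖pt p.1 p.2 - m‖) '' M₀) :=
    mp_pt.quasiMeasurePreserving.ae hproj
  have hA := (int_gA μ).indicator (measSA β₀)
  have hB := (int_gB α₀ μ).indicator (measSB β₀)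
  have hmp : MeasurePreserving (fun p : ℝ × ℝ => (-p.1, p.2)) volume volume :=
    (Measure.measurePreserving_neg (volume : Measure ℝ)).prod (MeasurePreserving.id volume)
  have hC : Integrable ((SC β₀).indicator (fun p : ℝ × ℝ => gB α₀ μ (-p.1, p.2))) :=
    (hmp.integrable_comp_of_integrable (int_gB α₀ μ)).indicator (measSC β₀)
  have hae : (fun p : ℝ × ℝ => ⟪pt p.1 p.2 - μ₀, mhat (pt p.1 p.2) - μ₀⟫ *
        ((2 * π)⁻¹ * Real.exp (-‖pt p.1 p.2 - μ₀‖ ^ 2 / 2))) =ᵐ[volume]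
      fun p => (2 * π)⁻¹ * (((SA β₀).indicator (gA μ) p + (SB β₀).indicator (gB α₀ μ) p)
        + (SC β₀).indicator (fun p : ℝ × ℝ => gB α₀ μ (-p.1, p.2)) p) := by
    filter_upwards [hproj', ae_lin 1 0 (by simp), ae_lin (Real.sin β₀) (-Real.cos β₀)
      (Or.inl hsb.ne'), ae_lin (Real.sin β₀) (Real.cos β₀) (Or.inl hsb.ne')]
    rintro ⟨x, y⟩ ⟨h1, h2⟩ n1 n2 n3
    simp only at h1 h2 n1 n2 n3 ⊢
    have hx : x ≠ 0 := by simpa using n1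
    have hm := h1
    rw [hM₀, M_iff] at hm
    have hmin : ∀ i : Fin 3, ∀ t : ℝ, 0 ≤ t → ‖pt x y - mhat (pt x y)‖ ≤
        ‖pt x y - pt (t * ![0, Real.cos α₀, -Real.cos α₀] i)
          (t * ![1, -Real.sin α₀, -Real.sin α₀] i)‖ := by
      intro i t ht
      rw [h2]
      refine csInf_le ⟨0, ?_⟩ ⟨_, ?_, rfl⟩
      · rintro _ ⟨m, _, rfl⟩
        exact norm_nonneg _
      · rw [hM₀, M_iff]
        exact ⟨i, t, ht, rfl⟩
    have hpick := pick _ _ hunit x y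
    rcases lt_or_ge (|x| * Real.sin β₀) (y * Real.cos β₀) with hA' | hA'
    · have mA : (x, y) ∈ SA β₀ := hA'
      have mB : (x, y) ∉ SB β₀ := by
        rintro ⟨h3, h4⟩
        simp only at h3 h4
        rw [abs_of_pos h3] at hA'
        linarith
      have mC : (x, y) ∉ SC β₀ := by
        rintro ⟨h3, h4⟩
        simp only at h3 h4
        rw [abs_of_neg h3] at hA'
        linarith
      rw [Set.indicator_of_mem mA, Set.indicator_of_notMem mB, Set.indicator_of_notMem mC]
      have hg := hgt _ _ hA'
      have hy : 0 < y := by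
        have := mul_nonneg (abs_nonneg x) hsb.le
        exact pos_of_mul_pos_left (this.trans_lt hA') hcb.le
      have q1 := mul_le_mul_of_nonneg_right (le_abs_self x) hc.le
      have q2 := mul_le_mul_of_nonneg_right (neg_abs_le x) hc.le
      have := hpick 0 (by simpa using hy) (by
        intro j hj
        fin_cases j
        · simp at hj
        · simp; nlinarith
        · simp; nlinarith) _ hm hmin
      rw [this, hμ₀, inner_pt, norm_pt]
      simp [gA]
      ring
    · rcases lt_or_gt_of_ne hx with hx' | hx'
      · rw [abs_of_neg hx'] at hA'
        have hlt' : y * Real.cos β₀ < -x * Real.sin β₀ :=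
          lt_of_le_of_ne hA' (fun h => n3 (by linarith))
        have mA : (x, y) ∉ SA β₀ := by
          intro h
          have : |x| * Real.sin β₀ < y * Real.cos β₀ := h
          rw [abs_of_neg hx'] at this
          linarith
        have mB : (x, y) ∉ SB β₀ := by
          rintro ⟨h3, h4⟩
          simp only at h3 h4
          linarith
        have mC : (x, y) ∈ SC β₀ := ⟨hx', hlt'⟩
        rw [Set.indicator_of_notMem mA, Set.indicator_of_notMem mB, Set.indicator_of_mem mC]
        have hg := hlt _ _ hlt'
        have q1 : 0 < -x * Real.cos α₀ := mul_pos (by linarith) hc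
        have hp : 0 < -(x * Real.cos α₀) + -(y * Real.sin α₀) := by
          rcases le_or_gt y 0 with hy | hy
          · nlinarith
          · nlinarith
        have := hpick 2 (by simpa using hp) (by
          intro j hj
          fin_cases j
          · simp; nlinarith
          · simp; nlinarith
          · simp at hj) _ hm hmin
        rw [this, hμ₀, inner_pt, norm_pt]
        simp [gB]
        generalize Real.exp _ = E
        ring
      · rw [abs_of_pos hx'] at hA'
        have hlt' : y * Real.cos β₀ < x * Real.sin β₀ :=
          lt_of_le_of_ne hA' (fun h => n2 (by linarith))
        have mA : (x, y) ∉ SA β₀ := by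
          intro h
          have : |x| * Real.sin β₀ < y * Real.cos β₀ := h
          rw [abs_of_pos hx'] at this
          linarith
        have mC : (x, y) ∉ SC β₀ := by
          rintro ⟨h3, h4⟩
          simp only at h3 h4
          linarith
        have mB : (x, y) ∈ SB β₀ := ⟨hx', hlt'⟩
        rw [Set.indicator_of_notMem mA, Set.indicator_of_notMem mC, Set.indicator_of_mem mB]
        have hg := hlt _ _ hlt'
        have q1 : 0 < x * Real.cos α₀ := mul_pos (by linarith) hc
        have hp : 0 < x * Real.cos α₀ + -(y * Real.sin α₀) := by
          rcases le_or_gt y 0 with hy | hy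
          · nlinarith
          · nlinarith
        have := hpick 1 (by simpa using hp) (by
          intro j hj
          fin_cases j
          · simp; nlinarith
          · simp at hj
          · simp; nlinarith) _ hm hmin
        rw [this, hμ₀, inner_pt, norm_pt]
        simp [gB]
        generalize Real.exp _ = E
        ring
  have hAB : Integrable (fun p => (SA β₀).indicator (gA μ) p + (SB β₀).indicator (gB α₀ μ) p) :=
    hA.add hB
  rw [← mp_pt.integral_comp me_pt, integral_congr_ae hae, integral_const_mul,
    integral_add hAB hC, integral_add hA hB,
    integral_indicator (measSA β₀), integral_indicator (measSB β₀), integral_indicator (measSC β₀),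
    int_C, int_A β₀ μ hβ, int_B α₀ β₀ μ hβ]
  have hsq : Real.sqrt (2 / π) = π⁻¹ * Real.sqrt (2 * π) := by
    have hpi := Real.pi_pos
    rw [show 2 / π = (π⁻¹) ^ 2 * (2 * π) by field_simp, Real.sqrt_mul (by positivity),
      Real.sqrt_sq (by positivity)]
  rw [hsq]
  have hpi := Real.pi_pos
  generalize (∫ y in Set.Ioi (0:ℝ), _ : ℝ) = I1
  generalize (∫ φ in (-(π / 2))..β₀, _ : ℝ) = I2
  field_simp
  ring
end

section
/- Let l be a positive integer and let 0 = α₀ < α₁ < ⋯ < α_l = 2π. Set φᵢ = αᵢ − αᵢ₋₁ for i = 1, …, l, and assume φᵢ ≤ φ₁ for all i and φ₁ ∈ (0, π]. Let M₀ = ⋃_{i=1}^{l} {t·(cos αᵢ, sin αᵢ) : t ≥ 0} ⊆ ℝ², and let m̂ : ℝ² → ℝ² be any measurable function such that for Lebesgue-almost every w, m̂(w) ∈ M₀ and ‖w − m̂(w)‖ = inf{‖w − m‖ : m ∈ M₀}. Then 2·∫_{ℝ²} ⟪w, m̂(w)⟫ · (2π)⁻¹ · exp(−‖w‖²/2) dw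 = 2 + (1/π)·∑_{i=1}^{l} sin(φᵢ). -/
open Real MeasureTheory RealInnerProductSpace

lemma aux_proj {E : Type*} [NormedAddCommGroup E] [InnerProductSpace ℝ E] {ι : Type*} (s : Finset ι)
    (hs : s.Nonempty) (u : ι → E) (hu : ∀ i, ‖u i‖ = 1) (M : Set E)
    (hM : M = {w | ∃ i ∈ s, ∃ t : ℝ, 0 ≤ t ∧ w = t • u i}) (w m : E) (hm : m ∈ M)
    (hmin : ‖w - m‖ = sInf ((fun m => ‖w - m‖) '' M)) :
    ⟪w, m⟫ = (max 0 (s.sup' hs (fun i => ⟪w, u i⟫))) ^ 2 := by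
  have key : ∀ j ∈ s, ∀ r : ℝ, 0 ≤ r → ‖w - m‖ ≤ ‖w - r • u j‖ := by
    intro j hj r hr
    rw [hmin]
    refine csInf_le ⟨0, ?_⟩ ⟨r • u j, ?_, rfl⟩
    · rintro _ ⟨x, _, rfl⟩
      exact norm_nonneg _
    · rw [hM]; exact ⟨j, hj, r, hr, rfl⟩
  have ex : ∀ j, ∀ r : ℝ, ‖w - r • u j‖ ^ 2 = ‖w‖ ^ 2 - 2 * r * ⟪w, u j⟫ + r ^ 2 := by
    intro j r
    rw [norm_sub_sq_real, inner_smul_right, norm_smul, hu]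
    simp; ring
  rw [hM] at hm
  obtain ⟨i, hi, t, ht, rfl⟩ := hm
  have key2 : ∀ j ∈ s, ∀ r : ℝ, 0 ≤ r →
      - 2 * t * ⟪w, u i⟫ + t ^ 2 ≤ - 2 * r * ⟪w, u j⟫ + r ^ 2 := by
    intro j hj r hr
    have h1 := pow_le_pow_left₀ (norm_nonneg _) (key j hj r hr) 2
    rw [ex, ex] at h1
    linarith
  have ht2 : t = max 0 ⟪w, u i⟫ := by
    have h := key2 i hi (max 0 ⟪w, u i⟫) (le_max_left _ _)
    rcases le_total 0 ⟪w, u i⟫ with h0 | h0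
    · rw [max_eq_right h0] at *
      have : (t - ⟪w, u i⟫) ^ 2 ≤ 0 := by nlinarith
      have := pow_eq_zero_iff (two_ne_zero) |>.1 (le_antisymm this (sq_nonneg _))
      linarith
    · rw [max_eq_left h0] at *
      have : 0 ≤ t * (-⟪w, u i⟫) := mul_nonneg ht (by linarith)
      have : t ^ 2 ≤ 0 := by nlinarith
      exact pow_eq_zero_iff (two_ne_zero) |>.1 (le_antisymm this (sq_nonneg _))
  have htw : t * ⟪w, u i⟫ = t ^ 2 := by
    rcases le_total 0 ⟪w, u i⟫ with h0 | h0
    · rw [max_eq_right h0] at ht2; rw [ht2]; ring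
    · rw [max_eq_left h0] at ht2; rw [ht2]; ring
  have hsup : max 0 (s.sup' hs (fun i => ⟪w, u i⟫)) = t := by
    apply le_antisymm
    · refine max_le ht (Finset.sup'_le _ _ ?_)
      intro j hj
      by_contra hlt
      push Not at hlt
      have h := key2 j hj ⟪w, u j⟫ (by linarith)
      nlinarith
    · rw [ht2]
      exact max_le_max le_rfl (Finset.le_sup' (fun i => ⟪w, u i⟫) hi)
  rw [hsup, inner_smul_right, htw]

lemma aux_cos {x d : ℝ} (hx : 0 ≤ x) (h1 : x ≤ d) (h2 : d ≤ 2 * π - x) : cos d ≤ cos x := by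
  have h := Real.cos_sub_cos d x
  have ha : 0 ≤ sin ((d + x) / 2) := sin_nonneg_of_nonneg_of_le_pi (by linarith) (by linarith)
  have hb : 0 ≤ sin ((d - x) / 2) := sin_nonneg_of_nonneg_of_le_pi (by linarith) (by linarith)
  nlinarith [mul_nonneg ha hb]

lemma aux_mono (l : ℕ) (α : ℕ → ℝ) (hmono : ∀ i < l, α i < α (i + 1)) :
    ∀ j, j ≤ l → ∀ i ≤ j, α i ≤ α j := by
  intro j
  induction j with
  | zero => intro _ i hi; rw [Nat.le_zero.1 hi]
  | succ n ih =>
    intro hn i hi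
    rcases Nat.lt_or_ge i (n + 1) with h | h
    · exact (ih (by omega) i (by omega)).trans (hmono n (by omega)).le
    · rw [le_antisymm hi h]

lemma aux_sup (l : ℕ) (hs : (Finset.Icc 1 l).Nonempty) (α : ℕ → ℝ)
    (hα0 : α 0 = 0) (hαl : α l = 2 * π)
    (hmono : ∀ i < l, α i < α (i + 1)) (k : ℕ) (hk : k < l) (hle : α (k + 1) - α k ≤ π) (θ x : ℝ)
    (h : (x = θ - α k ∧ 0 ≤ x ∧ 2 * θ ≤ α k + α (k + 1)) ∨
      (x = α (k + 1) - θ ∧ 0 ≤ x ∧ α k + α (k + 1) ≤ 2 * θ)) :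
    max 0 ((Finset.Icc 1 l).sup' hs (fun i => cos (θ - α i))) = cos x := by
  have mono := aux_mono l α hmono
  have ha0 : 0 ≤ α k := hα0 ▸ mono k hk.le 0 (by omega)
  have hbl : α (k + 1) ≤ 2 * π := hαl ▸ mono l le_rfl (k + 1) hk
  have hx0 : 0 ≤ x := by rcases h with h | h <;> exact h.2.1
  have hx1 : x ≤ π / 2 := by rcases h with h | h <;> linarith
  have hc0 : 0 ≤ cos x := cos_nonneg_of_neg_pi_div_two_le_of_le (by linarith [pi_pos]) hx1
  apply le_antisymm
  · refine max_le hc0 (Finset.sup'_le _ _ ?_)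
    intro j hj
    rw [Finset.mem_Icc] at hj
    have hj0 : 0 ≤ α j := hα0 ▸ mono j hj.2 0 (by omega)
    have hjl : α j ≤ 2 * π := hαl ▸ mono l le_rfl j hj.2
    rcases Nat.lt_or_ge k j with hjk | hjk
    · have := mono j hj.2 (k + 1) hjk
      rw [← cos_neg (θ - α j)]
      rcases h with h | h <;> apply aux_cos hx0 <;> linarith
    · have := mono k hk.le j hjk
      rcases h with h | h <;> apply aux_cos hx0 <;> linarith
  · refine le_trans ?_ (le_max_right _ _)
    rcases h with h | h
    · rcases Nat.eq_zero_or_pos k with h0 | h0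
      · have : cos x = cos (θ - α l) := by
          rw [h.1, hαl, h0, hα0, cos_sub_two_pi, sub_zero]
        rw [this]
        exact Finset.le_sup' (fun i => cos (θ - α i)) (Finset.mem_Icc.2 ⟨by omega, le_rfl⟩)
      · rw [h.1]
        exact Finset.le_sup' (fun i => cos (θ - α i)) (Finset.mem_Icc.2 ⟨by omega, hk.le⟩)
    · rw [h.1, ← cos_neg, neg_sub]
      exact Finset.le_sup' (fun i => cos (θ - α i)) (Finset.mem_Icc.2 ⟨by omega, hk⟩)

lemma aux_int_left (a b : ℝ) : ∫ θ in a..(a + b) / 2, cos (θ - a) ^ 2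
    = ((b - a) / 2 + sin (b - a) / 2) / 2 := by
  rw [intervalIntegral.integral_comp_sub_right (fun x => cos x ^ 2), integral_cos_sq]
  have : b - a = 2 * ((a + b) / 2 - a) := by ring
  rw [this, sin_two_mul]
  simp
  ring

lemma aux_int_right (a b : ℝ) : ∫ θ in (a + b) / 2..b, cos (b - θ) ^ 2
    = ((b - a) / 2 + sin (b - a) / 2) / 2 := by
  rw [intervalIntegral.integral_comp_sub_left (fun x => cos x ^ 2), integral_cos_sq]
  have : b - a = 2 * (b - (a + b) / 2) := by ring
  rw [this, sin_two_mul]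
  simp
  ring

lemma aux_angle (l : ℕ) (hs : (Finset.Icc 1 l).Nonempty) (α : ℕ → ℝ)
    (hα0 : α 0 = 0) (hαl : α l = 2 * π)
    (hmono : ∀ i < l, α i < α (i + 1)) (hle : ∀ k < l, α (k + 1) - α k ≤ π) :
    ∫ θ in Set.Ioo (-π) π, (max 0 ((Finset.Icc 1 l).sup' hs (fun i => cos (θ - α i)))) ^ 2
      = π + (1 / 2) * ∑ k ∈ Finset.range l, sin (α (k + 1) - α k) := by
  set G : ℝ → ℝ := fun θ => (max 0 ((Finset.Icc 1 l).sup' hs (fun i => cos (θ - α i)))) ^ 2 with hG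
  have hcont : Continuous G := by
    apply Continuous.pow
    apply continuous_const.max
    exact Continuous.finset_sup'_apply hs (fun i _ => by fun_prop)
  have hper : Function.Periodic G (2 * π) := by
    intro θ
    have : ∀ i, cos (θ + 2 * π - α i) = cos (θ - α i) := by
      intro i
      rw [show θ + 2 * π - α i = θ - α i + 2 * π by ring, cos_add_two_pi]
    simp only [hG, this]
  have hii : ∀ a b, IntervalIntegrable G volume a b := fun a b => hcont.intervalIntegrable a b
  rw [← integral_Ioc_eq_integral_Ioo, ← intervalIntegral.integral_of_le (by linarith [pi_pos])]
  have h1 := hper.intervalIntegral_add_eq (-π) 0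
  rw [show -π + 2 * π = π by ring, zero_add] at h1
  rw [h1, ← hα0, ← hαl, ← intervalIntegral.sum_integral_adjacent_intervals (fun k _ => hii _ _)]
  have h2 : ∀ k ∈ Finset.range l, ∫ θ in α k..α (k + 1), G θ
      = (α (k + 1) - α k) / 2 + (1 / 2) * sin (α (k + 1) - α k) := by
    intro k hk
    rw [Finset.mem_range] at hk
    have hlt := hmono k hk
    rw [← intervalIntegral.integral_add_adjacent_intervals (hii (α k) ((α k + α (k + 1)) / 2))
      (hii _ _)]
    have e1 : ∫ θ in α k..(α k + α (k + 1)) / 2, G θ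
        = ∫ θ in α k..(α k + α (k + 1)) / 2, cos (θ - α k) ^ 2 := by
      apply intervalIntegral.integral_congr
      intro θ hθ
      rw [Set.uIcc_of_le (by linarith)] at hθ
      simp only [hG]
      rw [aux_sup l hs α hα0 hαl hmono k hk (hle k hk) θ (θ - α k)
        (Or.inl ⟨rfl, by linarith [hθ.1], by linarith [hθ.2]⟩)]
    have e2 : ∫ θ in (α k + α (k + 1)) / 2..α (k + 1), G θ
        = ∫ θ in (α k + α (k + 1)) / 2..α (k + 1), cos (α (k + 1) - θ) ^ 2 := by
      apply intervalIntegral.integral_congr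
      intro θ hθ
      rw [Set.uIcc_of_le (by linarith)] at hθ
      simp only [hG]
      rw [aux_sup l hs α hα0 hαl hmono k hk (hle k hk) θ (α (k + 1) - θ)
        (Or.inr ⟨rfl, by linarith [hθ.2], by linarith [hθ.1]⟩)]
    rw [e1, e2, aux_int_left, aux_int_right]
    ring
  rw [Finset.sum_congr rfl h2, Finset.sum_add_distrib, ← Finset.sum_div, Finset.sum_range_sub,
    ← Finset.mul_sum, hα0, hαl]
  ring

lemma aux_radial : ∫ r in Set.Ioi (0 : ℝ), r ^ 3 * exp (-r ^ 2 / 2) = 2 := by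
  have h := integral_rpow_mul_exp_neg_mul_rpow (p := 2) (q := 3) (b := 1 / 2)
    (by norm_num) (by norm_num) (by norm_num)
  have e : ∀ r : ℝ, r ^ (3 : ℝ) * exp (-(1 / 2) * r ^ (2 : ℝ)) = r ^ 3 * exp (-r ^ 2 / 2) := by
    intro r
    rw [show (3 : ℝ) = ((3 : ℕ) : ℝ) by norm_num, show (2 : ℝ) = ((2 : ℕ) : ℝ) by norm_num,
      rpow_natCast, rpow_natCast]
    congr 2
    push_cast
    ring
  simp only [e] at h
  rw [h, show ((3 : ℝ) + 1) / 2 = 2 by norm_num, show -((3 : ℝ) + 1) / 2 = -2 by norm_num, Gamma_two,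
    rpow_neg (by norm_num), show (2 : ℝ) = ((2 : ℕ) : ℝ) by norm_num, rpow_natCast]
  norm_num

lemma aux_integral (f : EuclideanSpace ℝ (Fin 2) → ℝ) :
    ∫ w, f w = ∫ p : ℝ × ℝ, f (pt p.1 p.2) := by
  rw [← (PiLp.volume_preserving_toLp (Fin 2)).integral_comp
      (MeasurableEquiv.toLp 2 (Fin 2 → ℝ)).measurableEmbedding,
    ← (volume_preserving_finTwoArrow ℝ).symm.integral_comp
      (MeasurableEquiv.finTwoArrow).symm.measurableEmbedding]
  rfl

theorem multiple_halflines_bias_correction_case1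
    (l : ℕ) (hl : 0 < l) (α : ℕ → ℝ)
    (hα0 : α 0 = 0) (hαl : α l = 2 * π)
    (hmono : ∀ i < l, α i < α (i + 1))
    (φ : ℕ → ℝ) (hφ : ∀ i ∈ Finset.Icc 1 l, φ i = α i - α (i - 1))
    (hmax : ∀ i ∈ Finset.Icc 1 l, φ i ≤ φ 1)
    (hφ1 : φ 1 ∈ Set.Ioc 0 π)
    (M₀ : Set (EuclideanSpace ℝ (Fin 2)))
    (hM₀ : M₀ = {w | ∃ i ∈ Finset.Icc 1 l, ∃ t : ℝ, 0 ≤ t ∧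
      w = t • pt (Real.cos (α i)) (Real.sin (α i))})
    (mhat : EuclideanSpace ℝ (Fin 2) → EuclideanSpace ℝ (Fin 2))
    (hmeas : Measurable mhat)
    (hproj : ∀ᵐ w : EuclideanSpace ℝ (Fin 2),
      mhat w ∈ M₀ ∧ ‖w - mhat w‖ = sInf ((fun m => ‖w - m‖) '' M₀)) :
    2 * (∫ w : EuclideanSpace ℝ (Fin 2),
        ⟪w, mhat w⟫ * ((2 * π)⁻¹ * Real.exp (-‖w‖ ^ 2 / 2)))
      = 2 + (1 / π) * ∑ i ∈ Finset.Icc 1 l, Real.sin (φ i) := by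
  have hs : (Finset.Icc 1 l).Nonempty := ⟨1, Finset.mem_Icc.2 ⟨le_rfl, hl⟩⟩
  have hle : ∀ k < l, α (k + 1) - α k ≤ π := by
    intro k hk
    have hm : k + 1 ∈ Finset.Icc 1 l := Finset.mem_Icc.2 ⟨by omega, hk⟩
    have h1 := hφ (k + 1) hm
    have h2 := hmax (k + 1) hm
    simp only [Nat.add_sub_cancel] at h1
    linarith [hφ1.2]
  have hsum : ∑ i ∈ Finset.Icc 1 l, Real.sin (φ i)
      = ∑ k ∈ Finset.range l, sin (α (k + 1) - α k) := by
    have h := Finset.sum_Ico_add' (fun i => sin (α i - α (i - 1))) 0 l 1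
    simp only [Nat.add_sub_cancel] at h
    rw [Finset.range_eq_Ico, h]
    apply Finset.sum_congr
    · ext; simp
    · intro i hi; rw [hφ i hi]
  have hnorm : ∀ a b : ℝ, ‖pt a b‖ ^ 2 = a ^ 2 + b ^ 2 := by
    intro a b
    rw [EuclideanSpace.norm_sq_eq]
    simp [pt]
  have hinner : ∀ a b c d : ℝ, ⟪pt a b, pt c d⟫ = a * c + b * d := by
    intro a b c d
    simp [pt, PiLp.inner_apply]
    ring
  have hu : ∀ i, ‖pt (cos (α i)) (sin (α i))‖ = 1 := by
    intro i
    have := hnorm (cos (α i)) (sin (α i))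
    rw [cos_sq_add_sin_sq] at this
    exact (pow_eq_one_iff_of_nonneg (norm_nonneg _) two_ne_zero).1 this
  have hae : ∫ w : EuclideanSpace ℝ (Fin 2),
        ⟪w, mhat w⟫ * ((2 * π)⁻¹ * Real.exp (-‖w‖ ^ 2 / 2))
      = ∫ w : EuclideanSpace ℝ (Fin 2),
        (max 0 ((Finset.Icc 1 l).sup' hs (fun i => ⟪w, pt (cos (α i)) (sin (α i))⟫))) ^ 2
          * ((2 * π)⁻¹ * Real.exp (-‖w‖ ^ 2 / 2)) := by
    apply integral_congr_ae
    filter_upwards [hproj] with w hw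
    rw [aux_proj _ hs (fun i => pt (cos (α i)) (sin (α i))) hu M₀ hM₀ w _ hw.1 hw.2]
  rw [hae, aux_integral, ← integral_comp_polarCoord_symm, hsum]
  have hset : polarCoord.target = Set.Ioi (0 : ℝ) ×ˢ Set.Ioo (-π) π := rfl
  have hcongr : ∀ p ∈ polarCoord.target,
      p.1 • ((max 0 ((Finset.Icc 1 l).sup' hs (fun i =>
        ⟪pt (polarCoord.symm p).1 (polarCoord.symm p).2, pt (cos (α i)) (sin (α i))⟫))) ^ 2
          * ((2 * π)⁻¹ * Real.exp (-‖pt (polarCoord.symm p).1 (polarCoord.symm p).2‖ ^ 2 / 2)))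
      = (p.1 ^ 3 * exp (-p.1 ^ 2 / 2)) * ((2 * π)⁻¹ *
        (max 0 ((Finset.Icc 1 l).sup' hs (fun i => cos (p.2 - α i)))) ^ 2) := by
    rintro ⟨r, θ⟩ hp
    have hr : 0 < r := hp.1
    simp only [polarCoord_symm_apply, hinner, hnorm]
    have e1 : ∀ i, r * cos θ * cos (α i) + r * sin θ * sin (α i) = r * cos (θ - α i) := by
      intro i; rw [cos_sub]; ring
    have e2 : (r * cos θ) ^ 2 + (r * sin θ) ^ 2 = r ^ 2 := by
      rw [mul_pow, mul_pow, ← mul_add, cos_sq_add_sin_sq, mul_one]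
    have e3 : (Finset.Icc 1 l).sup' hs (fun i => r * cos (θ - α i))
        = r * (Finset.Icc 1 l).sup' hs (fun i => cos (θ - α i)) := by
      symm
      exact Finset.apply_sup'_eq_sup'_comp hs (fun x => r * x) (fun x y => by
        exact mul_max_of_nonneg x y hr.le)
    have e4 : ∀ x : ℝ, max 0 (r * x) = r * max 0 x := by
      intro x; rw [mul_max_of_nonneg _ _ hr.le, mul_zero]
    simp only [e1, e2, e3, e4, smul_eq_mul]
    ring
  rw [setIntegral_congr_fun (by rw [hset]; exact measurableSet_Ioi.prod measurableSet_Ioo) hcongr,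
    hset, Measure.volume_eq_prod]
  rw [setIntegral_prod_mul (fun r : ℝ => r ^ 3 * exp (-r ^ 2 / 2)) (fun θ => (2 * π)⁻¹ *
        (max 0 ((Finset.Icc 1 l).sup' hs (fun i => cos (θ - α i)))) ^ 2),
    aux_radial, integral_const_mul, aux_angle l hs α hα0 hαl hmono hle]
  field_simp
end

section
/- Let l be a positive integer and let 0 = α₀ < α₁ < ⋯ < α_l = 2π. Set φᵢ = αᵢ − αᵢ₋₁ for i = 1, …, l, and assume φᵢ ≤ φ₁ for all i and φ₁ ∈ (π, 2π]. Let M₀ = ⋃_{i=1}^{l} {t·(cos αᵢ, sin αᵢ) : t ≥ 0} ⊆ ℝ², and let m̂ : ℝ² → ℝ² be any measurable function such that for Lebesgue-almost every w, m̂(w) ∈ M₀ and ‖w − m̂(w)‖ = inf{‖w − m‖ : m ∈ M₀}. Then 2·∫_{ℝ²} ⟪w, m̂(w)⟫ · (2π)⁻¹ · exp(−‖w‖²/2) dw = 3 + (1/π)·(∑_{i=2}^{l} sin(φᵢ) − φ₁). -/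
open Real MeasureTheory RealInnerProductSpace

lemma radial_int : ∫ r in Set.Ioi (0:ℝ), r ^ 3 * Real.exp (-r ^ 2 / 2) = 2 := by
  have h := integral_rpow_mul_exp_neg_mul_rpow (p := 2) (q := 3) (b := 1/2)
    (by norm_num) (by norm_num) (by norm_num)
  have h2 : ∫ r in Set.Ioi (0:ℝ), r ^ 3 * Real.exp (-r ^ 2 / 2)
      = ∫ x in Set.Ioi (0:ℝ), x ^ (3:ℝ) * Real.exp (-(1/2) * x ^ (2:ℝ)) := by
    apply setIntegral_congr_fun measurableSet_Ioi
    intro x hx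
    have e3 : x ^ (3:ℝ) = x ^ 3 := by exact_mod_cast Real.rpow_natCast x 3
    have e2 : x ^ (2:ℝ) = x ^ 2 := by exact_mod_cast Real.rpow_natCast x 2
    simp only [e3, e2]
    congr 2
    ring
  rw [h2, h]
  have e4 : ((3:ℝ) + 1) / 2 = (1:ℕ) + 1 := by norm_num
  have e5 : (-((3:ℝ) + 1) / 2) = -(2:ℕ) := by norm_num
  rw [e4, Real.Gamma_nat_eq_factorial, e5, Real.rpow_neg (by norm_num), Real.rpow_natCast]
  norm_num

lemma J_small (x : ℝ) (h0 : 0 ≤ x) (h1 : x ≤ π / 2) :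
    ∫ t in (0:ℝ)..x, (max (Real.cos t) 0) ^ 2 = (Real.sin (2 * x) / 2 + x) / 2 := by
  have : ∫ t in (0:ℝ)..x, (max (Real.cos t) 0) ^ 2 = ∫ t in (0:ℝ)..x, Real.cos t ^ 2 := by
    apply intervalIntegral.integral_congr
    intro t ht
    rw [Set.uIcc_of_le h0] at ht
    have : 0 ≤ Real.cos t := Real.cos_nonneg_of_mem_Icc ⟨by linarith [ht.1, Real.pi_pos], by linarith [ht.2]⟩
    simp [max_eq_left this]
  rw [this, integral_cos_sq, Real.sin_two_mul]
  simp
  ring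

lemma J_cont : Continuous (fun t : ℝ => (max (Real.cos t) 0) ^ 2) := by fun_prop

lemma J_big (x : ℝ) (h0 : π / 2 ≤ x) (h1 : x ≤ π) :
    ∫ t in (0:ℝ)..x, (max (Real.cos t) 0) ^ 2 = π / 4 := by
  rw [← intervalIntegral.integral_add_adjacent_intervals (b := π / 2)
    (J_cont.intervalIntegrable _ _) (J_cont.intervalIntegrable _ _),
    J_small _ (by linarith [Real.pi_pos]) le_rfl]
  have : ∫ t in (π/2)..x, (max (Real.cos t) 0) ^ 2 = ∫ t in (π/2)..x, (0:ℝ) := by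
    apply intervalIntegral.integral_congr
    intro t ht
    rw [Set.uIcc_of_le h0] at ht
    have : Real.cos t ≤ 0 := Real.cos_nonpos_of_pi_div_two_le_of_le ht.1 (by linarith [ht.2, Real.pi_pos])
    simp [max_eq_right this]
  rw [this]
  have : 2 * (π / 2) = π := by ring
  simp [this]
  ring

lemma cos_le_aux (d x : ℝ) (h0 : 0 ≤ d) (h1 : d ≤ x) (h2 : x ≤ 2 * π - d) :
    Real.cos x ≤ Real.cos d := by
  rcases le_total x π with h | h
  · exact Real.cos_le_cos_of_nonneg_of_le_pi h0 h h1
  · rw [← Real.cos_two_pi_sub x]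
    exact Real.cos_le_cos_of_nonneg_of_le_pi h0 (by linarith) (by linarith)

/-- The angular profile. -/
noncomputable def GG (l : ℕ) (hl : 0 < l) (α : ℕ → ℝ) (θ : ℝ) : ℝ :=
  (Finset.Icc 1 l).sup' (Finset.nonempty_Icc.2 hl) (fun i => max (Real.cos (θ - α i)) 0)

lemma GG_cont (l : ℕ) (hl : 0 < l) (α : ℕ → ℝ) : Continuous (GG l hl α) := by
  unfold GG
  exact Continuous.finset_sup'_apply _ (fun i _ => by fun_prop)

lemma GG_periodic (l : ℕ) (hl : 0 < l) (α : ℕ → ℝ) :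
    Function.Periodic (GG l hl α) (2 * π) := by
  intro θ
  unfold GG
  congr 1
  ext i
  rw [show θ + 2 * π - α i = (θ - α i) + 2 * π by ring, Real.cos_add_two_pi]

lemma GG_eq (l : ℕ) (hl : 0 < l) (α : ℕ → ℝ) (θ c : ℝ) (k : ℕ) (hk : k ∈ Finset.Icc 1 l)
    (hc : Real.cos (θ - α k) = c) (hi : ∀ i ∈ Finset.Icc 1 l, max (Real.cos (θ - α i)) 0 ≤ max c 0) :
    GG l hl α θ = max c 0 := by
  unfold GG
  apply le_antisymm
  · exact Finset.sup'_le _ _ hi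
  · subst hc
    exact Finset.le_sup' (fun i => max (Real.cos (θ - α i)) 0) hk

section
variable (l : ℕ) (hl : 0 < l) (α : ℕ → ℝ)
    (hα0 : α 0 = 0) (hαl : α l = 2 * π)
    (hmono : ∀ i < l, α i < α (i + 1))

lemma al_mono (l : ℕ) (α : ℕ → ℝ) (hmono : ∀ i < l, α i < α (i + 1)) :
    ∀ i j, i ≤ j → j ≤ l → α i ≤ α j := by
  intro i j hij
  induction j, hij using Nat.le_induction with
  | base => intro _; exact le_rfl
  | succ n hn ih =>
    intro h
    exact (ih (by omega)).trans (hmono n (by omega)).le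

lemma GG_low (l : ℕ) (hl : 0 < l) (α : ℕ → ℝ)
    (hα0 : α 0 = 0) (hαl : α l = 2 * π)
    (hmono : ∀ i < l, α i < α (i + 1)) (k : ℕ) (hk : k < l) (θ : ℝ)
    (h1 : α k ≤ θ) (h2 : θ ≤ (α k + α (k+1)) / 2) :
    GG l hl α θ = max (Real.cos (θ - α k)) 0 := by
  have hm := al_mono l α hmono
  have key : ∀ i ∈ Finset.Icc 1 l, max (Real.cos (θ - α i)) 0 ≤ max (Real.cos (θ - α k)) 0 := by
    intro i hi
    rw [Finset.mem_Icc] at hi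
    apply max_le_max _ le_rfl
    have a1 := hm 0 k (by omega) (by omega)
    have a2 := hm (k+1) l (by omega) (by omega)
    have a3 := hm 0 i (by omega) (by omega)
    have a4 := hm i l (by omega) (by omega)
    rcases le_or_gt i k with h | h
    · have := hm i k h hk.le
      apply cos_le_aux <;> linarith
    · have := hm (k+1) i h hi.2
      rw [← Real.cos_neg (θ - α i)]
      apply cos_le_aux <;> linarith
  rcases Nat.eq_zero_or_pos k with h | h
  · subst h
    refine GG_eq l hl α θ _ l (Finset.mem_Icc.2 ⟨hl, le_rfl⟩) ?_ key
    rw [hα0, hαl, Real.cos_sub_two_pi, sub_zero]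
  · exact GG_eq l hl α θ _ k (Finset.mem_Icc.2 ⟨h, hk.le⟩) rfl key

lemma GG_high (l : ℕ) (hl : 0 < l) (α : ℕ → ℝ)
    (hα0 : α 0 = 0) (hαl : α l = 2 * π)
    (hmono : ∀ i < l, α i < α (i + 1)) (k : ℕ) (hk : k < l) (θ : ℝ)
    (h1 : (α k + α (k+1)) / 2 ≤ θ) (h2 : θ ≤ α (k+1)) :
    GG l hl α θ = max (Real.cos (α (k+1) - θ)) 0 := by
  have hm := al_mono l α hmono
  have key : ∀ i ∈ Finset.Icc 1 l, max (Real.cos (θ - α i)) 0 ≤ max (Real.cos (α (k+1) - θ)) 0 := by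
    intro i hi
    rw [Finset.mem_Icc] at hi
    apply max_le_max _ le_rfl
    have a1 := hm 0 k (by omega) (by omega)
    have a2 := hm (k+1) l (by omega) (by omega)
    have a3 := hm 0 i (by omega) (by omega)
    have a4 := hm i l (by omega) (by omega)
    rcases le_or_gt i k with h | h
    · have := hm i k h hk.le
      apply cos_le_aux <;> linarith
    · have := hm (k+1) i h hi.2
      rw [← Real.cos_neg (θ - α i)]
      apply cos_le_aux <;> linarith
  refine GG_eq l hl α θ _ (k+1) (Finset.mem_Icc.2 ⟨by omega, hk⟩) ?_ key
  rw [← Real.cos_neg, neg_sub]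
end

lemma GG_sector (l : ℕ) (hl : 0 < l) (α : ℕ → ℝ)
    (hα0 : α 0 = 0) (hαl : α l = 2 * π)
    (hmono : ∀ i < l, α i < α (i + 1)) (k : ℕ) (hk : k < l) :
    ∫ θ in α k..α (k+1), GG l hl α θ ^ 2
      = 2 * ∫ t in (0:ℝ)..((α (k+1) - α k) / 2), (max (Real.cos t) 0) ^ 2 := by
  have hc : Continuous (fun θ => GG l hl α θ ^ 2) := (GG_cont l hl α).pow 2
  have hlt := hmono k hk
  rw [← intervalIntegral.integral_add_adjacent_intervals (b := (α k + α (k+1)) / 2)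
    (hc.intervalIntegrable _ _) (hc.intervalIntegrable _ _)]
  have A : ∫ θ in α k..((α k + α (k+1)) / 2), GG l hl α θ ^ 2
      = ∫ θ in α k..((α k + α (k+1)) / 2), (fun t => (max (Real.cos t) 0) ^ 2) (θ - α k) := by
    apply intervalIntegral.integral_congr
    intro t ht
    rw [Set.uIcc_of_le (by linarith)] at ht
    simp only [GG_low l hl α hα0 hαl hmono k hk t ht.1 ht.2]
  have B : ∫ θ in ((α k + α (k+1)) / 2)..α (k+1), GG l hl α θ ^ 2
      = ∫ θ in ((α k + α (k+1)) / 2)..α (k+1), (fun t => (max (Real.cos t) 0) ^ 2) (α (k+1) - θ) := by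
    apply intervalIntegral.integral_congr
    intro t ht
    rw [Set.uIcc_of_le (by linarith)] at ht
    simp only [GG_high l hl α hα0 hαl hmono k hk t ht.1 ht.2]
  rw [A, B, intervalIntegral.integral_comp_sub_right (fun t => (max (Real.cos t) 0) ^ 2),
    intervalIntegral.integral_comp_sub_left (fun t => (max (Real.cos t) 0) ^ 2),
    sub_self, sub_self, show (α k + α (k+1)) / 2 - α k = (α (k+1) - α k) / 2 by ring,
    show α (k+1) - (α k + α (k+1)) / 2 = (α (k+1) - α k) / 2 by ring]
  ring

lemma sum_aux (f : ℕ → ℝ) (n : ℕ) :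
    ∑ i ∈ Finset.Icc 2 (n+1), f i = ∑ k ∈ Finset.range n, f (k + 2) := by
  induction n with
  | zero => simp
  | succ n ih => rw [Finset.sum_Icc_succ_top (by omega), ih, Finset.sum_range_succ]

lemma GG_total (l : ℕ) (hl : 0 < l) (α : ℕ → ℝ)
    (hα0 : α 0 = 0) (hαl : α l = 2 * π)
    (hmono : ∀ i < l, α i < α (i + 1))
    (φ : ℕ → ℝ) (hφ : ∀ i ∈ Finset.Icc 1 l, φ i = α i - α (i - 1))
    (hφ1 : φ 1 ∈ Set.Ioc π (2 * π)) :
    ∫ θ in (-π)..π, GG l hl α θ ^ 2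
      = π / 2 + ((2 * π - φ 1) + ∑ i ∈ Finset.Icc 2 l, Real.sin (φ i)) / 2 := by
  have hc : Continuous (fun θ => GG l hl α θ ^ 2) := (GG_cont l hl α).pow 2
  have hp : Function.Periodic (fun θ => GG l hl α θ ^ 2) (2 * π) := fun θ => by
    simp only [GG_periodic l hl α θ]
  have e1 := hp.intervalIntegral_add_eq (-π) 0
  rw [show -π + 2 * π = π by ring, zero_add] at e1
  rw [e1]
  have e2 := intervalIntegral.sum_integral_adjacent_intervals (f := fun θ => GG l hl α θ ^ 2)
    (μ := volume) (a := α) (n := l) (fun k _ => hc.intervalIntegrable _ _)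
  rw [hα0, hαl] at e2
  rw [← e2]
  rw [Finset.sum_congr rfl (fun k hk =>
    GG_sector l hl α hα0 hαl hmono k (Finset.mem_range.1 hk))]
  have hm := al_mono l α hmono
  have f1 : φ 1 = α 1 := by
    have := hφ 1 (Finset.mem_Icc.2 ⟨le_rfl, hl⟩)
    simpa [hα0] using this
  obtain ⟨n, rfl⟩ : ∃ n, l = n + 1 := ⟨l - 1, by omega⟩
  rw [Finset.sum_range_succ', sum_aux, J_big ((α (0+1) - α 0) / 2)
    (by rw [zero_add, hα0, ← f1]; linarith [hφ1.1]) (by rw [zero_add, hα0, ← f1]; linarith [hφ1.2])]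
  have e3 : ∀ k ∈ Finset.range n,
      2 * ∫ t in (0:ℝ)..((α (k+1+1) - α (k+1)) / 2), (max (Real.cos t) 0) ^ 2
      = Real.sin (φ (k+2)) / 2 + (α (k+1+1) - α (k+1)) / 2 := by
    intro k hk
    have hk' := Finset.mem_range.1 hk
    have g1 := hm 1 (k+1) (by omega) (by omega)
    have g2 := hm (k+1+1) (n+1) (by omega) (by omega)
    have g3 := hmono (k+1) (by omega)
    have g4 := hφ (k+2) (Finset.mem_Icc.2 ⟨by omega, by omega⟩)
    have g5 := hφ1.1
    rw [J_small _ (by linarith) (by linarith), g4]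
    rw [show k + 2 - 1 = k + 1 by omega, show 2 * ((α (k+1+1) - α (k+1)) / 2) = α (k+2) - α (k+1) by ring_nf]
    ring
  rw [Finset.sum_congr rfl e3, Finset.sum_add_distrib, ← Finset.sum_div, ← Finset.sum_div,
    Finset.sum_range_sub (fun k => α (k+1)), hαl, f1]
  simp only [zero_add]
  ring

lemma proj_val (l : ℕ) (hl : 0 < l) (α : ℕ → ℝ)
    (M₀ : Set (EuclideanSpace ℝ (Fin 2)))
    (hM₀ : M₀ = {w | ∃ i ∈ Finset.Icc 1 l, ∃ t : ℝ, 0 ≤ t ∧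
      w = t • pt (Real.cos (α i)) (Real.sin (α i))})
    (w m : EuclideanSpace ℝ (Fin 2)) (r θ : ℝ) (hr : 0 ≤ r)
    (h0 : w 0 = r * Real.cos θ) (h1 : w 1 = r * Real.sin θ)
    (hm : m ∈ M₀) (hd : ‖w - m‖ = sInf ((fun m => ‖w - m‖) '' M₀)) :
    ⟪w, m⟫ = r ^ 2 * GG l hl α θ ^ 2 := by
  have nrm : ∀ i (s : ℝ), ‖w - s • pt (Real.cos (α i)) (Real.sin (α i))‖ ^ 2
      = r ^ 2 - 2 * s * (r * Real.cos (θ - α i)) + s ^ 2 := by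
    intro i s
    rw [EuclideanSpace.real_norm_sq_eq]
    simp [Fin.sum_univ_two, pt, h0, h1, Real.cos_sub]
    linear_combination r ^ 2 * Real.sin_sq_add_cos_sq θ + s ^ 2 * Real.sin_sq_add_cos_sq (α i)
  have inn : ∀ i (s : ℝ), ⟪w, s • pt (Real.cos (α i)) (Real.sin (α i))⟫
      = s * (r * Real.cos (θ - α i)) := by
    intro i s
    simp [PiLp.inner_apply, Fin.sum_univ_two, pt, h0, h1, Real.cos_sub]
    ring
  have hle : ∀ i ∈ Finset.Icc 1 l, ∀ s : ℝ, 0 ≤ s →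
      ‖w - m‖ ^ 2 ≤ r ^ 2 - 2 * s * (r * Real.cos (θ - α i)) + s ^ 2 := by
    intro i hi s hs
    rw [← nrm]
    apply pow_le_pow_left₀ (norm_nonneg _)
    rw [hd]
    apply csInf_le
    · exact ⟨0, by rintro _ ⟨x, _, rfl⟩; exact norm_nonneg _⟩
    · exact ⟨_, by rw [hM₀]; exact ⟨i, hi, s, hs, rfl⟩, rfl⟩
  rw [hM₀] at hm
  obtain ⟨k, hk, t, ht, rfl⟩ := hm
  rw [nrm] at hle
  rw [inn]
  have hmx : ∀ x : ℝ, 0 ≤ max x 0 ∧ max x 0 * x = max x 0 ^ 2 := by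
    intro x
    refine ⟨le_max_right _ _, ?_⟩
    rcases le_total x 0 with h | h
    · simp [max_eq_right h]
    · simp [max_eq_left h, sq]
  have key : t = r * max (Real.cos (θ - α k)) 0 := by
    have h := hle k hk (r * max (Real.cos (θ - α k)) 0) (mul_nonneg hr (hmx _).1)
    have e := (hmx (Real.cos (θ - α k))).2
    have e' := le_max_left (Real.cos (θ - α k)) 0
    generalize hC : max (Real.cos (θ - α k)) 0 = C at *
    have : (t - r * C) ^ 2 ≤ 0 := by
      nlinarith [mul_nonneg (mul_nonneg ht hr) (sub_nonneg.2 e')]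
    have := pow_eq_zero_iff (two_ne_zero) |>.1 (le_antisymm this (sq_nonneg _))
    linarith
  have cmp : ∀ i ∈ Finset.Icc 1 l, r * max (Real.cos (θ - α i)) 0 ≤ r * max (Real.cos (θ - α k)) 0 := by
    intro i hi
    have h := hle i hi (r * max (Real.cos (θ - α i)) 0) (mul_nonneg hr (hmx _).1)
    have e := (hmx (Real.cos (θ - α i))).2
    have e' := (hmx (Real.cos (θ - α k))).2
    rw [key] at h
    apply le_of_sq_le_sq _ (mul_nonneg hr (hmx _).1)
    generalize max (Real.cos (θ - α k)) 0 = C at *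
    generalize max (Real.cos (θ - α i)) 0 = D at *
    have q1 : r * D * (r * Real.cos (θ - α i)) = (r * D) ^ 2 := by
      rw [mul_pow, ← e]; ring
    have q2 : r * C * (r * Real.cos (θ - α k)) = (r * C) ^ 2 := by
      rw [mul_pow, ← e']; ring
    nlinarith
  rcases hr.eq_or_lt with h | h
  · subst h; simp
  · rw [GG_eq l hl α θ _ k hk rfl (fun i hi => le_of_mul_le_mul_left (cmp i hi) h), key,
      ← (hmx (Real.cos (θ - α k))).2]
    ring

lemma integral_E (f : ℝ × ℝ → ℝ) :
    ∫ w : EuclideanSpace ℝ (Fin 2), f (w 0, w 1) = ∫ p : ℝ × ℝ, f p := by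
  rw [← (MeasureTheory.volume_preserving_finTwoArrow ℝ).integral_comp
    MeasurableEquiv.finTwoArrow.measurableEmbedding]
  rw [← (EuclideanSpace.volume_preserving_symm_measurableEquiv_toLp (Fin 2)).integral_comp
    (MeasurableEquiv.toLp 2 (Fin 2 → ℝ)).symm.measurableEmbedding]
  rfl

theorem multiple_halflines_bias_correction_case2
    (l : ℕ) (hl : 0 < l) (α : ℕ → ℝ)
    (hα0 : α 0 = 0) (hαl : α l = 2 * π)
    (hmono : ∀ i < l, α i < α (i + 1))
    (φ : ℕ → ℝ) (hφ : ∀ i ∈ Finset.Icc 1 l, φ i = α i - α (i - 1))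
    (hmax : ∀ i ∈ Finset.Icc 1 l, φ i ≤ φ 1)
    (hφ1 : φ 1 ∈ Set.Ioc π (2 * π))
    (M₀ : Set (EuclideanSpace ℝ (Fin 2)))
    (hM₀ : M₀ = {w | ∃ i ∈ Finset.Icc 1 l, ∃ t : ℝ, 0 ≤ t ∧
      w = t • pt (Real.cos (α i)) (Real.sin (α i))})
    (mhat : EuclideanSpace ℝ (Fin 2) → EuclideanSpace ℝ (Fin 2))
    (hmeas : Measurable mhat)
    (hproj : ∀ᵐ w : EuclideanSpace ℝ (Fin 2),
      mhat w ∈ M₀ ∧ ‖w - mhat w‖ = sInf ((fun m => ‖w - m‖) '' M₀)) :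
    2 * (∫ w : EuclideanSpace ℝ (Fin 2),
        ⟪w, mhat w⟫ * ((2 * π)⁻¹ * Real.exp (-‖w‖ ^ 2 / 2)))
      = 3 + (1 / π) * ((∑ i ∈ Finset.Icc 2 l, Real.sin (φ i)) - φ 1) := by
  set F : ℝ × ℝ → ℝ := fun p => (polarCoord p).1 ^ 2 * GG l hl α (polarCoord p).2 ^ 2 *
    ((2 * π)⁻¹ * Real.exp (-(polarCoord p).1 ^ 2 / 2)) with hF
  have e1 : ∫ w : EuclideanSpace ℝ (Fin 2), ⟪w, mhat w⟫ * ((2 * π)⁻¹ * Real.exp (-‖w‖ ^ 2 / 2))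
      = ∫ w : EuclideanSpace ℝ (Fin 2), F (w 0, w 1) := by
    apply integral_congr_ae
    filter_upwards [hproj] with w hw
    have hr : (polarCoord (w 0, w 1)).1 = ‖(Complex.mk (w 0) (w 1))‖ := by
      rw [polarCoord_apply, Complex.norm_eq_sqrt_sq_add_sq]
    have ht : (polarCoord (w 0, w 1)).2 = Complex.arg (Complex.mk (w 0) (w 1)) := by
      rw [polarCoord_apply]; rfl
    have hn : (polarCoord (w 0, w 1)).1 ^ 2 = ‖w‖ ^ 2 := by
      rw [polarCoord_apply, EuclideanSpace.real_norm_sq_eq, Real.sq_sqrt (by positivity)]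
      simp [Fin.sum_univ_two]
    simp only [hF]
    rw [proj_val l hl α M₀ hM₀ w (mhat w) (polarCoord (w 0, w 1)).1 (polarCoord (w 0, w 1)).2
      (by rw [hr]; positivity) (by rw [hr, ht, Complex.norm_mul_cos_arg])
      (by rw [hr, ht, Complex.norm_mul_sin_arg]) hw.1 hw.2, hn]
  rw [e1, integral_E, ← integral_comp_polarCoord_symm]
  have e2 : ∫ p in polarCoord.target, p.1 • F (polarCoord.symm p)
      = ∫ p in Set.Ioi (0:ℝ) ×ˢ Set.Ioo (-π) π,
        (fun r : ℝ => r ^ 3 * Real.exp (-r ^ 2 / 2)) p.1 *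
        (fun θ => (2 * π)⁻¹ * GG l hl α θ ^ 2) p.2 := by
    rw [polarCoord_target]
    apply setIntegral_congr_fun (measurableSet_Ioi.prod measurableSet_Ioo)
    intro p hp
    have := polarCoord.right_inv (x := p) (by rw [polarCoord_target]; exact hp)
    simp only [hF, this, smul_eq_mul]
    ring
  rw [e2, Measure.volume_eq_prod, setIntegral_prod_mul (fun r : ℝ => r ^ 3 * Real.exp (-r ^ 2 / 2))
    (fun θ => (2 * π)⁻¹ * GG l hl α θ ^ 2), radial_int, integral_const_mul,
    ← integral_Ioc_eq_integral_Ioo, ← intervalIntegral.integral_of_le (by linarith [Real.pi_pos]),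
    GG_total l hl α hα0 hαl hmono φ hφ hφ1]
  have := Real.pi_ne_zero
  field_simp
  ring
end
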